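/- arXiv:2302.10891 — 3 statements merged into one kernel-verified Lean document; each statement's English description precedes it below -/
import Mathlib

section
/- Let (X, d) be a metric space, let λ ∈ [0, 1), let f : X → X satisfy d(f(x), f(x')) ≤ λ·d(x, x') for all x, x' ∈ X, let ε > 0 and h : X → X satisfy d(h(x), f(x)) ≤ ε for all x ∈ X, and assume μ = λ + 2√ε < 1. If H* is a fixed point of h, then for every H ∈ X and every n ∈ ℕ, the n-th iterate satisfies d(hⁿ(H), H*) ≤ max(√ε, μⁿ · d(H, H*)). In particular, from any initialization H, the iterates of h converge exponentially fast to the closed ball of radius √ε around H*. -/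
/-- A map that uniformly `s²`-approximates a `lam`-contraction contracts distances by the factor
`lam + 2 * s`, as long as distances below `s` are replaced by `s`. -/
theorem dist_map_le_mul_max_of_approx_contraction {X : Type*} [PseudoMetricSpace X]
    {lam s : ℝ} (hlam : 0 ≤ lam) (hs : 0 ≤ s) {f h : X → X}
    (hf : ∀ x y : X, dist (f x) (f y) ≤ lam * dist x y)
    (hh : ∀ x : X, dist (h x) (f x) ≤ s * s) (x y : X) :
    dist (h x) (h y) ≤ (lam + 2 * s) * max s (dist x y) := by
  have hxy : dist (h x) (h y) ≤ dist (h x) (f x) + dist (f x) (f y) + dist (f y) (h y) :=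
    dist_triangle4 _ _ _ _
  rw [dist_comm (f y)] at hxy
  have hsmax : s * s ≤ s * max s (dist x y) :=
    mul_le_mul_of_nonneg_left (le_max_left _ _) hs
  have hlmax : lam * dist x y ≤ lam * max s (dist x y) :=
    mul_le_mul_of_nonneg_left (le_max_right _ _) hlam
  linarith [hf x y, hh x, hh y]

/-- Exponential convergence of the iterates of a 'mainly contractive' map `h` to the ball of
radius `√ε` around its fixed point `H*`: `d(hⁿ(H), H*) ≤ max(√ε, μⁿ d(H, H*))`, where
`μ = λ + 2√ε < 1` and `h` uniformly `ε`-approximates the `λ`-contraction `f`. -/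
theorem stmt9 {X : Type*} [MetricSpace X] (lam : ℝ) (hlam0 : 0 ≤ lam) (hlam1 : lam < 1)
    (f : X → X) (hf : ∀ x x' : X, dist (f x) (f x') ≤ lam * dist x x')
    (ε : ℝ) (hε : 0 < ε) (h : X → X) (hh : ∀ x : X, dist (h x) (f x) ≤ ε)
    (μ : ℝ) (hμ : μ = lam + 2 * Real.sqrt ε) (hμ1 : μ < 1)
    (Hstar : X) (hHstar : h Hstar = Hstar) :
    ∀ H : X, ∀ n : ℕ,
      dist (h^[n] H) Hstar ≤ max (Real.sqrt ε) (μ ^ n * dist H Hstar) := by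
  intro H n
  have hs : 0 ≤ Real.sqrt ε := Real.sqrt_nonneg ε
  have hμ0 : 0 ≤ μ := by rw [hμ]; positivity
  have hh' : ∀ x : X, dist (h x) (f x) ≤ Real.sqrt ε * Real.sqrt ε := by
    simpa only [Real.mul_self_sqrt hε.le] using hh
  induction n with
  | zero => simp
  | succ n ih =>
    have step := dist_map_le_mul_max_of_approx_contraction hlam0 hs hf hh' (h^[n] H) Hstar
    rw [hHstar, ← hμ] at step
    rw [Function.iterate_succ_apply']
    calc dist (h (h^[n] H)) Hstar
        ≤ μ * max (Real.sqrt ε) (dist (h^[n] H) Hstar) := step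
      _ ≤ μ * max (Real.sqrt ε) (μ ^ n * dist H Hstar) :=
          mul_le_mul_of_nonneg_left (max_le (le_max_left _ _) ih) hμ0
      _ = max (μ * Real.sqrt ε) (μ ^ (n + 1) * dist H Hstar) := by
          rw [mul_max_of_nonneg _ _ hμ0, pow_succ', mul_assoc]
      _ ≤ max (Real.sqrt ε) (μ ^ (n + 1) * dist H Hstar) :=
          max_le_max_right _ (mul_le_of_le_one_left hs hμ1.le)
end

section
/- Let (X, d) be a metric space, let λ ∈ [0, 1), let f : X → X satisfy d(f(x), f(x')) ≤ λ·d(x, x') for all x, x' ∈ X, let ε > 0 and h : X → X satisfy d(h(x), f(x)) ≤ ε for all x ∈ X, and assume μ = λ + 2√ε < 1. Let H* be a fixed point of h and let U* ∈ X satisfy d(H*, U*) ≤ ε. Then for every H ∈ X and every n ∈ ℕ, d(hⁿ(H), U*) ≤ max(√ε, μⁿ· d(H, H*)) + ε; in particular limsup_{n→∞} d(hⁿ(H), U*) ≤ √ε + ε. -/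
/-- A map uniformly `ε`-close to a `lam`-Lipschitz map satisfies the Lipschitz bound up to an
additive error `2 * ε`. -/
theorem dist_le_of_approx_lipschitz {X : Type*} [PseudoMetricSpace X] {lam ε : ℝ} {f h : X → X}
    (hf : ∀ x x' : X, dist (f x) (f x') ≤ lam * dist x x')
    (hh : ∀ x : X, dist (h x) (f x) ≤ ε) (x y : X) :
    dist (h x) (h y) ≤ lam * dist x y + 2 * ε := by
  have hy := hh y
  rw [dist_comm] at hy
  linarith [dist_triangle4 (h x) (f x) (f y) (h y), hf x y, hh x]

/-- A sequence with `d (n + 1) ≤ lam * d n + 2 * s ^ 2` decays geometrically with ratio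
`lam + 2 * s ≤ 1` until it falls below `s`, and stays below `s` from then on. -/
theorem le_max_pow_mul_of_le_affine {lam s : ℝ} (hlam : 0 ≤ lam) (hs : 0 ≤ s)
    (hμ : lam + 2 * s ≤ 1) {d : ℕ → ℝ} (hd : ∀ n, d (n + 1) ≤ lam * d n + 2 * s ^ 2) (n : ℕ) :
    d n ≤ max s ((lam + 2 * s) ^ n * d 0) := by
  induction n with
  | zero => simp
  | succ n ih =>
    have hstep := hd n
    rcases le_max_iff.mp ih with hn | hn
    · exact le_max_of_le_left (by nlinarith)
    · rcases le_total (d n) s with hsn | hsn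
      · exact le_max_of_le_left (by nlinarith)
      · refine le_max_of_le_right ?_
        calc d (n + 1) ≤ (lam + 2 * s) * d n := by nlinarith
          _ ≤ (lam + 2 * s) * ((lam + 2 * s) ^ n * d 0) := by gcongr
          _ = (lam + 2 * s) ^ (n + 1) * d 0 := by ring

/-- Iterating the 'mainly contractive' map `h` from any initialization yields the optimal
solution `U*` up to the explicit error `√ε + ε`: `d(hⁿ(H), U*) ≤ max(√ε, μⁿ d(H, H*)) + ε`,
and `limsup_{n→∞} d(hⁿ(H), U*) ≤ √ε + ε`, where `H*` is the fixed point of `h`,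
`d(H*, U*) ≤ ε`, `μ = λ + 2√ε < 1`, and `h` uniformly `ε`-approximates the
`λ`-contraction `f`. -/
theorem stmt10 {X : Type*} [MetricSpace X] (lam : ℝ) (hlam0 : 0 ≤ lam) (hlam1 : lam < 1)
    (f : X → X) (hf : ∀ x x' : X, dist (f x) (f x') ≤ lam * dist x x')
    (ε : ℝ) (hε : 0 < ε) (h : X → X) (hh : ∀ x : X, dist (h x) (f x) ≤ ε)
    (μ : ℝ) (hμ : μ = lam + 2 * Real.sqrt ε) (hμ1 : μ < 1)
    (Hstar : X) (hHstar : h Hstar = Hstar)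
    (Ustar : X) (hUstar : dist Hstar Ustar ≤ ε) :
    (∀ H : X, ∀ n : ℕ,
      dist (h^[n] H) Ustar ≤ max (Real.sqrt ε) (μ ^ n * dist H Hstar) + ε) ∧
    (∀ H : X,
      Filter.limsup (fun n : ℕ => dist (h^[n] H) Ustar) Filter.atTop
        ≤ Real.sqrt ε + ε) := by
  subst hμ
  have hs : 0 < Real.sqrt ε := Real.sqrt_pos.mpr hε
  have bound : ∀ H : X, ∀ n : ℕ, dist (h^[n] H) Ustar ≤
      max (Real.sqrt ε) ((lam + 2 * Real.sqrt ε) ^ n * dist H Hstar) + ε := by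
    intro H n
    have hstep : ∀ k, dist (h^[k + 1] H) Hstar ≤
        lam * dist (h^[k] H) Hstar + 2 * Real.sqrt ε ^ 2 := by
      intro k
      have hk := dist_le_of_approx_lipschitz hf hh (h^[k] H) Hstar
      rwa [hHstar, ← Function.iterate_succ_apply' h, ← Real.sq_sqrt hε.le] at hk
    have hn := le_max_pow_mul_of_le_affine (d := fun k => dist (h^[k] H) Hstar)
      hlam0 hs.le hμ1.le hstep n
    exact (dist_triangle _ Hstar _).trans (add_le_add hn hUstar)
  refine ⟨bound, fun H => ?_⟩
  have hlim : Filter.Tendsto (fun n : ℕ => (lam + 2 * Real.sqrt ε) ^ n * dist H Hstar)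
      Filter.atTop (nhds 0) := by
    simpa using (tendsto_pow_atTop_nhds_zero_of_lt_one (by positivity) hμ1).mul_const
      (dist H Hstar)
  refine Filter.limsup_le_of_le
    (Filter.isCoboundedUnder_le_of_le Filter.atTop fun _ => dist_nonneg) ?_
  filter_upwards [hlim.eventually_le_const hs] with n hn
  simpa [max_eq_left hn] using bound H n
end

section
/- Let h : ℝᵖ × ℝⁿ → ℝⁿ and L : ℝⁿ → ℝ be differentiable, and let H* : ℝᵖ → ℝⁿ be a differentiable map satisfying h(θ, H*(θ)) = H*(θ) for all θ. Fix θ₀, write D_θ h and D_H h for the partial Fréchet derivatives of h at (θ₀, H*(θ₀)), and assume I − D_H h is invertible on ℝⁿ. Then the Fréchet derivative of the map θ ↦ L(H*(θ)) at θ₀ equals DL(H*(θ₀)) ∘ (I − D_H h)⁻¹ ∘ D_θ h. -/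
/-- Backpropagation at the equilibrium: if `h(θ, H*(θ)) = H*(θ)` with `h`, `L`, `H*`
differentiable, and `I − D_H h` is invertible at `(θ₀, H*(θ₀))`, then the Fréchet derivative
of `θ ↦ L(H*(θ))` at `θ₀` equals `DL(H*(θ₀)) ∘ (I − D_H h)⁻¹ ∘ D_θ h`. -/
theorem stmt15 (p n : ℕ) (h : (Fin p → ℝ) × (Fin n → ℝ) → (Fin n → ℝ))
    (hh : Differentiable ℝ h)
    (L : (Fin n → ℝ) → ℝ) (hL : Differentiable ℝ L)
    (Hstar : (Fin p → ℝ) → (Fin n → ℝ)) (hHstar : Differentiable ℝ Hstar)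
    (hfix : ∀ θ : Fin p → ℝ, h (θ, Hstar θ) = Hstar θ)
    (θ₀ : Fin p → ℝ)
    (Dθ : (Fin p → ℝ) →L[ℝ] (Fin n → ℝ)) (DH : (Fin n → ℝ) →L[ℝ] (Fin n → ℝ))
    (hDθ : Dθ = fderiv ℝ (fun θ : Fin p → ℝ => h (θ, Hstar θ₀)) θ₀)
    (hDH : DH = fderiv ℝ (fun H : Fin n → ℝ => h (θ₀, H)) (Hstar θ₀))
    (hinv : IsUnit (ContinuousLinearMap.id ℝ (Fin n → ℝ) - DH)) :
    fderiv ℝ (fun θ : Fin p → ℝ => L (Hstar θ)) θ₀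
      = ((fderiv ℝ L (Hstar θ₀)).comp
          (Ring.inverse (ContinuousLinearMap.id ℝ (Fin n → ℝ) - DH))).comp Dθ := by
  have hD : HasFDerivAt h (fderiv ℝ h (θ₀, Hstar θ₀)) (θ₀, Hstar θ₀) := (hh _).hasFDerivAt
  have hS : HasFDerivAt Hstar (fderiv ℝ Hstar θ₀) θ₀ := (hHstar _).hasFDerivAt
  have hDθ' : Dθ = (fderiv ℝ h (θ₀, Hstar θ₀)).comp (.inl ℝ _ _) := by
    rw [hDθ]
    exact (hD.comp θ₀ (hasFDerivAt_prodMk_left θ₀ (Hstar θ₀))).fderiv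
  have hDH' : DH = (fderiv ℝ h (θ₀, Hstar θ₀)).comp (.inr ℝ _ _) := by
    rw [hDH]
    exact (hD.comp (Hstar θ₀) (hasFDerivAt_prodMk_right θ₀ (Hstar θ₀))).fderiv
  have htotal : HasFDerivAt Hstar
      ((fderiv ℝ h (θ₀, Hstar θ₀)).comp ((ContinuousLinearMap.id ℝ _).prod (fderiv ℝ Hstar θ₀)))
      θ₀ := by
    have hcomp := hD.comp θ₀ ((hasFDerivAt_id θ₀).prodMk hS)
    exact hcomp.congr_of_eventuallyEq (.of_forall fun θ => (hfix θ).symm)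
  have heq : (ContinuousLinearMap.id ℝ (Fin n → ℝ) - DH).comp (fderiv ℝ Hstar θ₀) = Dθ := by
    ext1 v
    have hv := DFunLike.congr_fun (hS.unique htotal) v
    have hsplit : ((v, fderiv ℝ Hstar θ₀ v) : (Fin p → ℝ) × (Fin n → ℝ))
        = (v, 0) + (0, fderiv ℝ Hstar θ₀ v) := by simp
    simp only [ContinuousLinearMap.comp_apply, ContinuousLinearMap.prod_apply,
      ContinuousLinearMap.id_apply] at hv
    rw [hsplit, map_add] at hv
    simp only [hDθ', hDH', ContinuousLinearMap.comp_apply, sub_apply,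
      ContinuousLinearMap.id_apply, ContinuousLinearMap.inl_apply, ContinuousLinearMap.inr_apply]
    exact sub_eq_of_eq_add hv
  have hcancel : (Ring.inverse (ContinuousLinearMap.id ℝ (Fin n → ℝ) - DH)).comp
      (ContinuousLinearMap.id ℝ (Fin n → ℝ) - DH) = ContinuousLinearMap.id ℝ (Fin n → ℝ) :=
    Ring.inverse_mul_cancel _ hinv
  rw [← heq, ContinuousLinearMap.comp_assoc, ← ContinuousLinearMap.comp_assoc (Ring.inverse _),
    hcancel, ContinuousLinearMap.id_comp]
  exact ((hL _).hasFDerivAt.comp θ₀ hS).fderiv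
end
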